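/- arXiv:1401.7388 — 2 statements merged into one kernel-verified Lean document; each statement's English description precedes it below -/
import Mathlib

section
/- A union C of a d-complete collection of d-cubes in {0,1}^n is a maximum class of VC dimension d if and only if every iterated reduction C^S, over all (d−1)-element sets S of coordinate directions, is a tree (i.e., connected). -/
open Finset

/-- A concept class `C` shatters a coordinate set `I` if every assignment of
values to the coordinates in `I` is realized by some concept in `C`. -/
def Shatters {α : Type*} (C : Finset (α → Bool)) (I : Finset α) : Prop :=
  ∀ f : α → Bool, ∃ c ∈ C, ∀ i ∈ I, c i = f i

/-- The VC dimension of a concept class: the largest cardinality of a shattered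
coordinate set. -/
noncomputable def vcDim {α : Type*} [Fintype α] [DecidableEq α]
    (C : Finset (α → Bool)) : ℕ :=
  letI := Classical.decPred (Shatters C)
  (Finset.univ.filter (Shatters C)).sup Finset.card

/-- The subcube with free coordinate set `S` and anchor `a`: all vectors that
agree with `a` outside `S`.  Its dimension is `S.card`. -/
def subcube {α : Type*} [Fintype α] [DecidableEq α] (S : Finset α) (a : α → Bool) :
    Finset (α → Bool) :=
  Finset.univ.filter fun c => ∀ i ∉ S, c i = a i

/-- The iterated reduction of a `d`-complete collection along a `(d-1)`-set `S`
of directions: the graph on the projected cube `{0,1}^{[n]\S}` whose edges are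
the projections of the `d`-cubes of the collection whose direction set contains
`S`.  `f T` is the anchor of the cube of the collection with direction set `T`. -/
noncomputable def iteratedReduction (n : ℕ) (f : Finset (Fin n) → (Fin n → Bool))
    (S : Finset (Fin n)) : SimpleGraph ({i : Fin n // i ∉ S} → Bool) :=
  SimpleGraph.fromRel (fun u v =>
    ∃ x, x ∉ S ∧
      (∃ c ∈ subcube (insert x S) (f (insert x S)),
        ∀ i : {i : Fin n // i ∉ S}, c i.1 = u i) ∧
      (∃ c ∈ subcube (insert x S) (f (insert x S)),
        ∀ i : {i : Fin n // i ∉ S}, c i.1 = v i))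

/-- `u` is a vertex of the iterated reduction along `S`: it is the projection of
a `(d-1)`-face (equivalently, of a point) of a cube of the collection whose
direction set contains `S`. -/
def isReductionVertex (n : ℕ) (f : Finset (Fin n) → (Fin n → Bool))
    (S : Finset (Fin n)) (u : {i : Fin n // i ∉ S} → Bool) : Prop :=
  ∃ x, x ∉ S ∧ ∃ c ∈ subcube (insert x S) (f (insert x S)),
    ∀ i : {i : Fin n // i ∉ S}, c i.1 = u i

theorem mem_subcube_iff {α : Type*} [Fintype α] [DecidableEq α] (S : Finset α)
    (a c : α → Bool) : c ∈ subcube S a ↔ ∀ i ∉ S, c i = a i := by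
  simp [subcube]

theorem pajor_aux {n : ℕ} (C : Finset (Fin n → Bool)) (P : Finset (Fin n) → Prop)
    [DecidablePred P] (hP : ∀ I, _root_.Shatters C I → P I) :
    C.card ≤ (Finset.univ.filter P).card := by
  classical
  let φ : (Fin n → Bool) → Finset (Fin n) := fun c => Finset.univ.filter (fun i => c i = true)
  have hφ : Function.Injective φ := by
    intro a b h
    funext i
    have : i ∈ φ a ↔ i ∈ φ b := by rw [h]
    simp only [φ, Finset.mem_filter, Finset.mem_univ, true_and] at this
    exact Bool.eq_iff_iff.mpr this
  rw [← Finset.card_image_of_injective C hφ]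
  refine (Finset.card_le_card_shatterer _).trans (Finset.card_le_card ?_)
  intro I hI
  rw [Finset.mem_shatterer] at hI
  simp only [Finset.mem_filter, Finset.mem_univ, true_and]
  apply hP
  intro g
  obtain ⟨u, hu, hu'⟩ := hI (Finset.filter_subset (fun i => g i = true) I)
  obtain ⟨c, hc, rfl⟩ := Finset.mem_image.1 hu
  refine ⟨c, hc, fun i hi => ?_⟩
  have : i ∈ I ∩ φ c ↔ i ∈ I.filter (fun i => g i = true) := by rw [hu']
  simp only [φ, Finset.mem_filter, Finset.mem_inter, Finset.mem_univ, true_and, hi] at this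
  exact Bool.eq_iff_iff.mpr this

theorem card_small_sets (n d : ℕ) :
    (Finset.univ.filter (fun I : Finset (Fin n) => I.card ≤ d)).card =
      ∑ i ∈ Finset.range (d + 1), n.choose i := by
  classical
  rw [Finset.card_eq_sum_card_fiberwise (f := Finset.card) (t := Finset.range (d + 1))]
  · refine Finset.sum_congr rfl fun i hi => ?_
    have : (Finset.univ.filter (fun I : Finset (Fin n) => I.card ≤ d)).filter
        (fun I => I.card = i) = Finset.powersetCard i Finset.univ := by
      ext I
      simp only [Finset.mem_range] at hi
      simp only [Finset.mem_filter, Finset.mem_univ, true_and, Finset.mem_powersetCard,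
        Finset.subset_univ]
      omega
    rw [this, Finset.card_powersetCard, Finset.card_univ, Fintype.card_fin]
  · intro I hI
    simp only [Finset.coe_filter, Set.mem_setOf_eq, Finset.mem_univ, true_and] at hI
    simp only [Finset.coe_range, Set.mem_Iio]
    omega

theorem card_lower {n d : ℕ} (hdn : d ≤ n) (f : Finset (Fin n) → (Fin n → Bool))
    (C : Finset (Fin n → Bool))
    (hC : ∀ T : Finset (Fin n), T.card = d → ∀ c, (∀ i ∉ T, c i = f T i) → c ∈ C) :
    ∑ i ∈ Finset.range (d + 1), n.choose i ≤ C.card := by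
  classical
  have h1 := pajor_aux Cᶜ (fun I => ¬ (Iᶜ).card ≤ d) (by
    intro I hI hcard
    obtain ⟨T, hT, hTd⟩ := Finset.exists_superset_card_eq hcard (by simpa using hdn)
    obtain ⟨c, hc, hcI⟩ := hI (f T)
    rw [Finset.mem_compl] at hc
    refine hc (hC T hTd c fun i hi => hcI i ?_)
    by_contra h
    exact hi (hT (Finset.mem_compl.2 h)))
  have h2 := Finset.card_filter_add_card_filter_not (s := (Finset.univ : Finset (Finset (Fin n))))
    (fun I => (Iᶜ).card ≤ d)
  have h3 : (Finset.univ.filter (fun I : Finset (Fin n) => (Iᶜ).card ≤ d)).card =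
      (Finset.univ.filter (fun I : Finset (Fin n) => I.card ≤ d)).card := by
    refine Finset.card_bij (fun I _ => Iᶜ) ?_ ?_ ?_
    · intro I hI; simpa using hI
    · intro I _ J _ h; exact compl_injective h
    · intro I hI; exact ⟨Iᶜ, by simpa using hI, by simp⟩
  rw [h3, card_small_sets] at h2
  have h4 := Finset.card_add_card_compl C
  simp only [Finset.card_univ, Fintype.card_finset, Fintype.card_fin, Fintype.card_pi,
    Fintype.card_bool, Finset.prod_const] at h2 h4
  omega

theorem shatters_mono {n : ℕ} {C : Finset (Fin n → Bool)} {I J : Finset (Fin n)} (h : I ⊆ J)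
    (hJ : _root_.Shatters C J) : _root_.Shatters C I := by
  intro g
  obtain ⟨c, hc, h'⟩ := hJ g
  exact ⟨c, hc, fun i hi => h' i (h hi)⟩

theorem shatters_card_le_vcDim {n : ℕ} {C : Finset (Fin n → Bool)} {I : Finset (Fin n)}
    (h : _root_.Shatters C I) : I.card ≤ vcDim C := by
  unfold _root_.vcDim
  exact Finset.le_sup (f := Finset.card) (by simpa using h)

theorem isVertex_iff {n : ℕ} (f : Finset (Fin n) → (Fin n → Bool))
    (S : Finset (Fin n)) (x : Fin n) (u : {i : Fin n // i ∉ S} → Bool) :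
    (∃ c ∈ subcube (insert x S) (f (insert x S)), ∀ i : {i : Fin n // i ∉ S}, c i.1 = u i) ↔
      ∀ i : {i : Fin n // i ∉ S}, i.1 ≠ x → u i = f (insert x S) i.1 := by
  classical
  constructor
  · rintro ⟨c, hc, h⟩ i hi
    rw [mem_subcube_iff] at hc
    rw [← h i]
    exact hc _ (by simp [hi, i.2])
  · intro h
    refine ⟨fun i => if hi : i ∈ S then true else u ⟨i, hi⟩, ?_, ?_⟩
    · rw [mem_subcube_iff]
      intro i hi
      simp only [Finset.mem_insert, not_or] at hi
      simp only [hi.2, dite_false]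
      exact h ⟨i, hi.2⟩ hi.1
    · intro i
      simp [i.2]

theorem not_shatters_of_connected {n d : ℕ} (hd : 1 ≤ d)
    (f : Finset (Fin n) → (Fin n → Bool))
    (H : ∀ S : Finset (Fin n), S.card = d - 1 →
      ∀ u v : {i : Fin n // i ∉ S} → Bool,
        isReductionVertex n f S u → isReductionVertex n f S v →
          (iteratedReduction n f S).Reachable u v)
    (U : Finset (Fin n)) (hU : U.card = d + 1) (k : ℕ) :
    ∀ T : Finset (Fin n), T.card = d → (T \ U).card = k →
      ∃ T' : Finset (Fin n), T'.card = d ∧ T' ⊆ U ∧ ∀ i ∈ U, i ∉ T' → i ∉ T ∧ f T' i = f T i := by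
  classical
  induction k with
  | zero =>
    intro T hT hk
    rw [Finset.card_eq_zero, Finset.sdiff_eq_empty_iff_subset] at hk
    exact ⟨T, hT, hk, fun i _ hi => ⟨hi, rfl⟩⟩
  | succ k ih =>
    intro T hT hk
    obtain ⟨x, hx⟩ : (T \ U).Nonempty := Finset.card_pos.1 (by omega)
    obtain ⟨hxT, hxU⟩ := Finset.mem_sdiff.1 hx
    obtain ⟨y, hyU, hyT⟩ : ∃ y ∈ U, y ∉ T := Finset.exists_mem_notMem_of_card_lt_card (by omega)
    set S := T.erase x with hS
    have hxS : x ∉ S := by simp [hS]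
    have hyS : y ∉ S := by simp [hS, hyT]
    have hTS : insert x S = T := Finset.insert_erase hxT
    have hSc : S.card = d - 1 := by rw [hS, Finset.card_erase_of_mem hxT, hT]
    let u : {i : Fin n // i ∉ S} → Bool := fun i => f T i.1
    let v : {i : Fin n // i ∉ S} → Bool := fun i => f (insert y S) i.1
    have hu : isReductionVertex n f S u :=
      ⟨x, hxS, (isVertex_iff f S x u).2 (fun i _ => by simp [u, hTS])⟩
    have hv : isReductionVertex n f S v :=
      ⟨y, hyS, (isVertex_iff f S y v).2 (fun i _ => rfl)⟩
    have key : ∃ z ∈ U, z ∉ S ∧ ∃ w : {i : Fin n // i ∉ S} → Bool,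
        (∀ i : {i : Fin n // i ∉ S}, i.1 ≠ z → w i = f (insert z S) i.1) ∧
        ∀ i : {i : Fin n // i ∉ S}, i.1 ∈ U → w i = f T i.1 := by
      by_contra hno
      push Not at hno
      have hr := H S hSc u v hu hv
      rw [SimpleGraph.reachable_iff_reflTransGen] at hr
      have hag : ∀ w, Relation.ReflTransGen (iteratedReduction n f S).Adj u w →
          ∀ i : {i : Fin n // i ∉ S}, i.1 ∈ U → w i = f T i.1 := by
        intro w hw
        induction hw with
        | refl => intro i _; rfl
        | @tail b c hb hbc ihb =>
          have : ∃ z, z ∉ S ∧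
              (∀ i : {i : Fin n // i ∉ S}, i.1 ≠ z → b i = f (insert z S) i.1) ∧
              (∀ i : {i : Fin n // i ∉ S}, i.1 ≠ z → c i = f (insert z S) i.1) := by
            unfold iteratedReduction at hbc
            rw [SimpleGraph.fromRel_adj] at hbc
            rcases hbc.2 with ⟨z, hz, h1, h2⟩ | ⟨z, hz, h1, h2⟩
            · exact ⟨z, hz, (isVertex_iff f S z b).1 h1, (isVertex_iff f S z c).1 h2⟩
            · exact ⟨z, hz, (isVertex_iff f S z b).1 h2, (isVertex_iff f S z c).1 h1⟩
          obtain ⟨z, hz, h1, h2⟩ := this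
          intro i hi
          by_cases hzU : z ∈ U
          · obtain ⟨j, hj, hj'⟩ := hno z hzU hz b h1
            exact absurd (ihb j hj) hj'
          · have hiz : i.1 ≠ z := fun h => hzU (h ▸ hi)
            rw [h2 i hiz, ← h1 i hiz]
            exact ihb i hi
      obtain ⟨j, hj, hj'⟩ := hno y hyU hyS v (fun i _ => rfl)
      exact hj' (hag v hr j hj)
    obtain ⟨z, hzU, hzS, w, hw1, hw2⟩ := key
    have hcard : (insert z S).card = d := by rw [Finset.card_insert_of_notMem hzS]; omega
    have hsd : (insert z S) \ U = (T \ U).erase x := by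
      ext i
      simp only [hS, Finset.mem_sdiff, Finset.mem_insert, Finset.mem_erase]
      constructor
      · rintro ⟨rfl | h, h2⟩
        · exact absurd hzU h2
        · exact ⟨h.1, h.2, h2⟩
      · rintro ⟨h1, h2, h3⟩
        exact ⟨Or.inr ⟨h1, h2⟩, h3⟩
    obtain ⟨T', hT', hT'U, h'⟩ := ih (insert z S) hcard (by
      rw [hsd, Finset.card_erase_of_mem hx, hk]; rfl)
    refine ⟨T', hT', hT'U, fun i hi hiT' => ?_⟩
    obtain ⟨h1, h2⟩ := h' i hi hiT'
    simp only [Finset.mem_insert, not_or] at h1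
    have hix : i ≠ x := fun h => hxU (h ▸ hi)
    refine ⟨fun h => h1.2 (by rw [hS]; exact Finset.mem_erase.2 ⟨hix, h⟩), ?_⟩
    rw [h2, ← hw1 ⟨i, h1.2⟩ h1.1, hw2 ⟨i, h1.2⟩ hi]

theorem connected_of_not_shatters {n d : ℕ} (hd : 1 ≤ d)
    (f : Finset (Fin n) → (Fin n → Bool)) (C : Finset (Fin n → Bool))
    (hC : ∀ T : Finset (Fin n), T.card = d → ∀ c, (∀ i ∉ T, c i = f T i) → c ∈ C)
    (hsh : ∀ I : Finset (Fin n), I.card = d + 1 → ¬ _root_.Shatters C I)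
    (S : Finset (Fin n)) (hS : S.card = d - 1) (k : ℕ) :
    ∀ u v : {i : Fin n // i ∉ S} → Bool,
        (Finset.univ.filter (fun i => u i ≠ v i)).card ≤ k →
        isReductionVertex n f S u → isReductionVertex n f S v →
          (iteratedReduction n f S).Reachable u v := by
  classical
  -- four patterns on two coordinates cannot all occur
  have four : ∀ x y : {i : Fin n // i ∉ S}, x ≠ y →
      ¬ ∀ a b : Bool, ∃ w, isReductionVertex n f S w ∧ w x = a ∧ w y = b := by
    intro x y hxy h
    refine hsh (insert x.1 (insert y.1 S)) ?_ ?_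
    · rw [Finset.card_insert_of_notMem, Finset.card_insert_of_notMem y.2]
      · omega
      · simp only [Finset.mem_insert, not_or]
        exact ⟨fun h => hxy (Subtype.ext h), x.2⟩
    · intro g
      obtain ⟨w, ⟨z, hz, hw⟩, hwx, hwy⟩ := h (g x.1) (g y.1)
      rw [isVertex_iff] at hw
      refine ⟨fun i => if hi : i ∈ S then g i else w ⟨i, hi⟩, ?_, ?_⟩
      · refine hC (insert z S) ?_ _ ?_
        · rw [Finset.card_insert_of_notMem hz]; omega
        · intro i hi
          simp only [Finset.mem_insert, not_or] at hi
          simp only [hi.2, dite_false]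
          exact hw ⟨i, hi.2⟩ hi.1
      · intro i hi
        by_cases hiS : i ∈ S
        · simp [hiS]
        · simp only [hiS, dite_false]
          simp only [Finset.mem_insert, hiS, or_false] at hi
          rcases hi with rfl | rfl
          · exact hwx
          · exact hwy
  induction k with
  | zero =>
    intro u v hk _ _
    have : u = v := by
      funext i
      by_contra h
      have : i ∈ Finset.univ.filter (fun i => u i ≠ v i) := by simpa using h
      have := Finset.card_pos.2 ⟨i, this⟩
      omega
    rw [this]
  | succ k ih =>
    intro u v hk hu hv
    by_cases huv : u = v
    · rw [huv]
    obtain ⟨x, hx⟩ := Function.ne_iff.1 huv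
    let P : Bool → {i : Fin n // i ∉ S} → Bool :=
      fun b i => if i = x then b else f (insert x.1 S) i.1
    have hP' : ∀ b, ∀ i : {i : Fin n // i ∉ S}, i.1 ≠ x.1 → P b i = f (insert x.1 S) i.1 := by
      intro b i hi
      simp only [P]
      rw [if_neg (fun h => hi (congrArg _ h))]
    have hP : ∀ b, isReductionVertex n f S (P b) := fun b =>
      ⟨x.1, x.2, (isVertex_iff f S x.1 _).2 (hP' b)⟩
    have hPx : ∀ b, P b x = b := fun b => by simp [P]
    have hPag : ∀ b, ∀ y, u y = v y → P b y = u y := by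
      intro b y hy
      have hyx : x ≠ y := fun h => hx (h ▸ hy)
      by_contra hne
      apply four x y hyx
      intro a b'
      have hPy : ∀ b₁ b₂, P b₁ y = P b₂ y := by
        intro b₁ b₂; simp [P, Ne.symm hyx]
      by_cases hb : P b y = b'
      · exact ⟨P a, hP a, hPx a, by rw [← hb]; exact hPy _ _⟩
      · have huy : u y = b' := by
          revert hne hb; cases P b y <;> cases u y <;> cases b' <;> simp
        by_cases ha : u x = a
        · exact ⟨u, hu, ha, huy⟩
        · refine ⟨v, hv, ?_, hy ▸ huy⟩
          revert hx ha; cases u x <;> cases v x <;> cases a <;> simp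
    have hlt : ∀ D : Finset {i : Fin n // i ∉ S}, D ⊆ Finset.univ.filter (fun i => u i ≠ v i) →
        x ∉ D → D.card ≤ k := by
      intro D hD hxD
      have : D.card < (Finset.univ.filter (fun i => u i ≠ v i)).card :=
        Finset.card_lt_card ⟨hD, fun h => hxD (h (by simpa using hx))⟩
      omega
    have r1 : (iteratedReduction n f S).Reachable u (P (u x)) := by
      refine ih _ _ (hlt _ ?_ ?_) hu (hP _)
      · intro i hi
        simp only [Finset.mem_filter, Finset.mem_univ, true_and] at hi ⊢
        exact fun h => hi (hPag _ i h).symm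
      · simp [hPx]
    have r2 : (iteratedReduction n f S).Reachable (P (v x)) v := by
      refine ih _ _ (hlt _ ?_ ?_) (hP _) hv
      · intro i hi
        simp only [Finset.mem_filter, Finset.mem_univ, true_and] at hi ⊢
        exact fun h => hi ((hPag _ i h).trans h)
      · simp [hPx]
    have r3 : (iteratedReduction n f S).Adj (P (u x)) (P (v x)) := by
      unfold iteratedReduction
      rw [SimpleGraph.fromRel_adj]
      refine ⟨fun h => hx ?_, Or.inl ⟨x.1, x.2, (isVertex_iff f S x.1 _).2 (hP' _),
        (isVertex_iff f S x.1 _).2 (hP' _)⟩⟩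
      have := congrFun h x
      rwa [hPx, hPx] at this
    exact r1.trans (r3.reachable.trans r2)

/-- A union `C` of a `d`-complete collection of `d`-cubes in the `n`-cube is a
maximum class of VC dimension `d` iff every `(d-1)`-iterated reduction is a tree,
i.e. connected (any two of its vertices are joined by a path). -/
theorem maximum_iff_iteratedReductions_connected (n d : ℕ) (hd : 1 ≤ d) (hdn : d ≤ n)
    (f : Finset (Fin n) → (Fin n → Bool))
    (C : Finset (Fin n → Bool))
    (hC : C = (Finset.univ.filter (fun S : Finset (Fin n) => S.card = d)).biUnion
      (fun S => subcube S (f S))) :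
    (C.card = ∑ i ∈ Finset.range (d + 1), n.choose i ∧ vcDim C = d) ↔
    (∀ S : Finset (Fin n), S.card = d - 1 →
      ∀ u v : {i : Fin n // i ∉ S} → Bool,
        isReductionVertex n f S u → isReductionVertex n f S v →
          (iteratedReduction n f S).Reachable u v) := by
  classical
  have hmem : ∀ T : Finset (Fin n), T.card = d → ∀ c, (∀ i ∉ T, c i = f T i) → c ∈ C := by
    intro T hT c hc
    rw [hC, Finset.mem_biUnion]
    exact ⟨T, by simpa using hT, (mem_subcube_iff _ _ _).2 hc⟩
  constructor
  · rintro ⟨-, hvc⟩ S hS u v hu hv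
    refine connected_of_not_shatters hd f C hmem ?_ S hS _ u v le_rfl hu hv
    intro I hI hsh
    have := shatters_card_le_vcDim hsh
    omega
  · intro H
    have hns : ∀ U : Finset (Fin n), U.card = d + 1 → ¬ _root_.Shatters C U := by
      intro U hU hsh
      obtain ⟨c, hc, hcU⟩ := hsh (fun i => ! f (U.erase i) i)
      rw [hC, Finset.mem_biUnion] at hc
      obtain ⟨T, hT, hcT⟩ := hc
      rw [mem_subcube_iff] at hcT
      obtain ⟨T', hT', hT'U, h'⟩ := not_shatters_of_connected hd f H U hU _ T
        (by simpa using hT) rfl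
      obtain ⟨i, hiU, hiT'⟩ : ∃ y ∈ U, y ∉ T' :=
        Finset.exists_mem_notMem_of_card_lt_card (by omega)
      have hT'e : T' = U.erase i := by
        apply Finset.eq_of_subset_of_card_le
        · intro j hj
          exact Finset.mem_erase.2 ⟨fun h => hiT' (h ▸ hj), hT'U hj⟩
        · rw [Finset.card_erase_of_mem hiU]; omega
      obtain ⟨h1, h2⟩ := h' i hiU hiT'
      have h3 := hcU i hiU
      rw [hcT i h1, ← h2, ← hT'e] at h3
      revert h3
      cases f T' i <;> simp
    have hsmall : ∀ I, _root_.Shatters C I → I.card ≤ d := by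
      intro I hI
      by_contra h
      obtain ⟨U, hUI, hU⟩ := Finset.exists_subset_card_eq (s := I) (n := d + 1) (by omega)
      exact hns U hU (shatters_mono hUI hI)
    refine ⟨le_antisymm ?_ (card_lower hdn f C hmem), le_antisymm ?_ ?_⟩
    · rw [← card_small_sets]
      exact pajor_aux C _ hsmall
    · unfold _root_.vcDim
      apply Finset.sup_le
      intro I hI
      exact hsmall I (by simpa using hI)
    · obtain ⟨T, -, hT⟩ := Finset.exists_subset_card_eq
        (s := (Finset.univ : Finset (Fin n))) (n := d) (by simpa using hdn)
      have : _root_.Shatters C T := by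
        intro g
        refine ⟨fun i => if i ∈ T then g i else f T i, hmem T hT _ ?_, ?_⟩
        · intro i hi; simp [hi]
        · intro i hi; simp [hi]
      have := shatters_card_le_vcDim this
      omega
end

section
/- Let C be a maximal class of VC dimension 2 in {0,1}^4 that is not maximum. Then the complement of C is a forest with exactly 4 edges (one per coordinate direction) and exactly 2 connected components, and the deficiency of C is 1. -/
open Finset

/-- The one-inclusion graph of the complement of `C` in the 4-cube: vertices are
the points not in `C`, adjacent when they differ in exactly one coordinate. -/
def complementGraph (C : Finset (Fin 4 → Bool)) :
    SimpleGraph {v : Fin 4 → Bool // v ∉ C} :=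
  SimpleGraph.fromRel (fun u v => ∃! i : Fin 4, u.1 i ≠ v.1 i)

/-- Number of shift positions and base-point mask for the edges in direction `i`. -/
def baseMask : Fin 4 → ℕ
  | 0 => 21845
  | 1 => 13107
  | 2 => 3855
  | 3 => 255

def shiftOf : Fin 4 → ℕ
  | 0 => 1
  | 1 => 2
  | 2 => 4
  | 3 => 8

/-- The mask of base points of the edges of direction `i` inside the vertex mask `m`. -/
def edgeMask (i : Fin 4) (m : ℕ) : ℕ := m &&& (m >>> shiftOf i) &&& baseMask i

def isComplete (m : ℕ) : Bool :=
  !(Nat.beq (edgeMask 0 m) 0) && (!(Nat.beq (edgeMask 1 m) 0) &&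
    (!(Nat.beq (edgeMask 2 m) 0) && !(Nat.beq (edgeMask 3 m) 0)))

def points : List ℕ := [0,1,2,3,4,5,6,7,8,9,10,11,12,13,14,15]

def redundant (m : ℕ) : Bool :=
  points.any fun j => m.testBit j && isComplete (m ^^^ 2 ^ j)

def cnt (m : ℕ) : ℕ := points.countP m.testBit

def pairMask (i : Fin 4) (a : ℕ) : ℕ := 2 ^ a ||| 2 ^ (a + shiftOf i)

def fourMask (a b c d : ℕ) : ℕ :=
  (pairMask 0 a ||| pairMask 1 b) ||| (pairMask 2 c ||| pairMask 3 d)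

def verdict (m a b c d : ℕ) : Bool :=
  redundant m || (Nat.beq (cnt m) 5 || (Nat.beq (cnt m) 6 &&
    (Nat.beq (edgeMask 0 m) (2 ^ a) && (Nat.beq (edgeMask 1 m) (2 ^ b) &&
    (Nat.beq (edgeMask 2 m) (2 ^ c) && Nat.beq (edgeMask 3 m) (2 ^ d))))))

theorem core : ([0,2,4,6,8,10,12,14].all fun a => [0,1,4,5,8,9,12,13].all fun b =>
    [0,1,2,3,8,9,10,11].all fun c => [0,1,2,3,4,5,6,7].all fun d =>
    verdict (fourMask a b c d) a b c d) = true := by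
  decide +kernel

theorem forest_count {V : Type*} [Fintype V] (G : SimpleGraph V) (h : G.IsAcyclic) :
    Nat.card G.edgeSet + Nat.card G.ConnectedComponent = Nat.card V := by
  classical
  have h1 : ∀ c : G.ConnectedComponent,
      (∑ v : c.supp, G.degree v.1) + 2 = 2 * Fintype.card c.supp := by
    intro c
    have ht : (G.induce c.supp).IsTree := ⟨c.connected_toSimpleGraph, h.induce _⟩
    have h2 := (G.induce c.supp).sum_degrees_eq_twice_card_edges
    have h3 := ht.card_edgeFinset
    have h4 : ∀ v : c.supp, (G.induce c.supp).degree v = G.degree v.1 := by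
      intro v
      apply SimpleGraph.degree_induce_of_neighborSet_subset
      intro w hw
      have hv := v.2
      rw [SimpleGraph.ConnectedComponent.mem_supp_iff] at hv ⊢
      rw [← hv]
      exact (SimpleGraph.ConnectedComponent.connectedComponentMk_eq_of_adj hw).symm
    simp only [h4] at h2
    omega
  have h5 : ∀ f : V → ℕ, ∑ c : G.ConnectedComponent, ∑ v : c.supp, f v.1 = ∑ v, f v := by
    intro f
    rw [← (Equiv.sigmaFiberEquiv G.connectedComponentMk).sum_comp, Fintype.sum_sigma]
    refine Finset.sum_congr rfl fun c _ => ?_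
    exact Fintype.sum_equiv (Equiv.subtypeEquivRight (p := fun v => v ∈ c.supp) (q := fun v => G.connectedComponentMk v = c) (fun v => Iff.rfl)) _ _ fun v => rfl
  have h6 := h5 (fun v => G.degree v)
  have h7 := h5 (fun _ => 1)
  have h8 := G.sum_degrees_eq_twice_card_edges
  have h9 := Finset.sum_congr (rfl : (Finset.univ : Finset G.ConnectedComponent) = _) (fun c _ => h1 c)
  rw [Finset.sum_add_distrib, ← Finset.mul_sum] at h9
  simp only [Finset.sum_const, Finset.card_univ, smul_eq_mul, mul_one] at h7 h9
  rw [Nat.card_eq_fintype_card, Nat.card_eq_fintype_card, Nat.card_eq_fintype_card,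
    ← SimpleGraph.edgeFinset_card]
  omega

theorem shatters_mono_s16 {C C' : Finset (Fin 4 → Bool)} (h : C ⊆ C') {I : Finset (Fin 4)}
    (hI : Shatters C I) : Shatters C' I := by
  intro f
  obtain ⟨c, hc, h2⟩ := hI f
  exact ⟨c, h hc, h2⟩

theorem vcDim_mono {C C' : Finset (Fin 4 → Bool)} (h : C ⊆ C') : vcDim C ≤ vcDim C' := by
  classical
  unfold _root_.vcDim
  apply Finset.sup_mono
  intro I hI
  simp only [Finset.mem_filter, Finset.mem_univ, true_and] at hI ⊢
  exact shatters_mono_s16 h hI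

theorem edge_of_vcDim_le {C : Finset (Fin 4 → Bool)} (h : vcDim C ≤ 2) (i : Fin 4) :
    ∃ u : Fin 4 → Bool, u i = false ∧ u ∉ C ∧ Function.update u i true ∉ C := by
  classical
  by_contra hne
  push Not at hne
  have hs : Shatters C (Finset.univ.erase i) := by
    intro f
    by_cases hf : Function.update f i false ∈ C
    · refine ⟨_, hf, fun j hj => ?_⟩
      rw [Function.update_of_ne (Finset.ne_of_mem_erase hj)]
    · have h2 := hne (Function.update f i false) (by simp) hf
      refine ⟨_, h2, fun j hj => ?_⟩
      rw [Function.update_of_ne (Finset.ne_of_mem_erase hj),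
        Function.update_of_ne (Finset.ne_of_mem_erase hj)]
  have h3 : (Finset.univ.erase i).card ≤ vcDim C := by
    unfold _root_.vcDim
    apply Finset.le_sup (f := Finset.card)
    simpa using hs
  rw [Finset.card_erase_of_mem (Finset.mem_univ i)] at h3
  simp at h3
  omega

theorem vcDim_le_of_edge {C : Finset (Fin 4 → Bool)}
    (h : ∀ i : Fin 4, ∃ u : Fin 4 → Bool, u i = false ∧ u ∉ C ∧ Function.update u i true ∉ C) :
    vcDim C ≤ 2 := by
  classical
  unfold _root_.vcDim
  apply Finset.sup_le
  intro S hS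
  simp only [Finset.mem_filter, Finset.mem_univ, true_and] at hS
  by_contra hlt
  have key : ∀ S : Finset (Fin 4), ¬ S.card ≤ 2 → ∃ i, ∀ j, j ≠ i → j ∈ S := by decide
  obtain ⟨i, hi⟩ := key S hlt
  obtain ⟨u, hu, hu1, hu2⟩ := h i
  obtain ⟨c, hc, hcu⟩ := hS u
  cases hci : c i
  · apply hu1
    convert hc using 1
    funext j
    by_cases hj : j = i
    · rw [hj, hu, hci]
    · exact (hcu j (hi j hj)).symm
  · apply hu2
    convert hc using 1
    funext j
    by_cases hj : j = i
    · subst hj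
      rw [hci, Function.update_self]
    · rw [Function.update_of_ne hj]
      exact (hcu j (hi j hj)).symm

/-- Removing a point from the complement destroys all edges in some direction. -/
theorem minimal_of_maximal {C : Finset (Fin 4 → Bool)} (hvc : vcDim C = 2)
    (hmaximal : ∀ C' : Finset (Fin 4 → Bool), C ⊆ C' → vcDim C' = 2 → C' = C)
    {v : Fin 4 → Bool} (hv : v ∉ C)
    (h : ∀ i : Fin 4, ∃ u : Fin 4 → Bool, u i = false ∧ (u ∉ C ∧ u ≠ v) ∧
      (Function.update u i true ∉ C ∧ Function.update u i true ≠ v)) : False := by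
  have h1 : vcDim (insert v C) ≤ 2 := by
    apply vcDim_le_of_edge
    intro i
    obtain ⟨u, a, b, c⟩ := h i
    refine ⟨u, a, ?_, ?_⟩ <;> simp [Finset.mem_insert, b, c]
  have h2 := vcDim_mono (Finset.subset_insert v C)
  have h3 := hmaximal _ (Finset.subset_insert v C) (by omega)
  exact hv (h3 ▸ Finset.mem_insert_self v C)

/-- Binary code of a vertex. -/
def code (v : Fin 4 → Bool) : ℕ :=
  (v 0).toNat + 2 * (v 1).toNat + 4 * (v 2).toNat + 8 * (v 3).toNat

theorem code_inj : ∀ u v : Fin 4 → Bool, code u = code v → u = v := by decide +kernel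
theorem code_lt : ∀ u : Fin 4 → Bool, code u < 16 := by decide +kernel
theorem code_surj : ∀ j < 16, ∃ u : Fin 4 → Bool, code u = j := by decide +kernel
theorem code_update : ∀ (i : Fin 4) (u : Fin 4 → Bool), u i = false →
    code (Function.update u i true) = code u + shiftOf i := by decide +kernel
theorem baseMask_code : ∀ (i : Fin 4) (u : Fin 4 → Bool),
    (baseMask i).testBit (code u) = !(u i) := by decide +kernel

theorem testBit_edgeMask (i : Fin 4) (m : ℕ) (u : Fin 4 → Bool) :
    (edgeMask i m).testBit (code u) = true ↔
      u i = false ∧ m.testBit (code u) = true ∧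
        m.testBit (code (Function.update u i true)) = true := by
  cases hu : u i
  · rw [code_update i u hu]
    simp [edgeMask, baseMask_code, hu, Nat.testBit_shiftRight, add_comm]
  · simp [edgeMask, baseMask_code, hu]

theorem exists_of_edgeMask (i : Fin 4) (m : ℕ) (h : edgeMask i m ≠ 0) :
    ∃ u : Fin 4 → Bool, u i = false ∧ m.testBit (code u) = true ∧
        m.testBit (code (Function.update u i true)) = true := by
  obtain ⟨j, hj⟩ := Nat.exists_testBit_of_ne_zero h
  have hb : (baseMask i).testBit j = true := by
    simp only [edgeMask, Nat.testBit_and, Bool.and_eq_true] at hj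
    exact hj.2
  have hlt : j < 16 := by
    by_contra hge
    have h1 : baseMask i < 2 ^ 16 := by
      have h0 : ∀ i, baseMask i < 2 ^ 16 := by decide
      exact h0 i
    have h2 := Nat.testBit_lt_two_pow (lt_of_lt_of_le h1
      (Nat.pow_le_pow_right (by norm_num) (not_lt.mp hge)))
    rw [h2] at hb
    exact Bool.noConfusion hb
  obtain ⟨u, rfl⟩ := code_surj j hlt
  exact ⟨u, (testBit_edgeMask i m u).1 hj⟩

theorem exists_of_isComplete (m : ℕ) (h : isComplete m = true) (i : Fin 4) :
    ∃ u : Fin 4 → Bool, u i = false ∧ m.testBit (code u) = true ∧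
        m.testBit (code (Function.update u i true)) = true := by
  apply exists_of_edgeMask
  simp only [isComplete, Bool.and_eq_true, Bool.not_eq_true', ← Bool.not_eq_true, Nat.beq_eq] at h
  obtain ⟨h0, h1, h2, h3⟩ := h
  fin_cases i
  exacts [h0, h1, h2, h3]

theorem card_eq_cnt (C : Finset (Fin 4 → Bool)) (m : ℕ)
    (hD : ∀ v, v ∉ C ↔ m.testBit (code v) = true) : C.card + cnt m = 16 := by
  have h1 : Cᶜ.card = cnt m := by
    have h2 : (Cᶜ.image code) = (points.filter m.testBit).toFinset := by
      ext j
      simp only [Finset.mem_image, Finset.mem_compl, List.mem_toFinset, List.mem_filter, hD]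
      constructor
      · rintro ⟨v, hv, rfl⟩
        refine ⟨?_, hv⟩
        have : ∀ j < 16, j ∈ points := by decide
        exact this _ (code_lt v)
      · rintro ⟨hj, hm⟩
        have : ∀ j ∈ points, j < 16 := by decide
        obtain ⟨u, rfl⟩ := code_surj j (this j hj)
        exact ⟨u, hm, rfl⟩
    rw [← Finset.card_image_of_injective _ (fun u v h => code_inj u v h), h2,
      List.toFinset_card_of_nodup (List.Nodup.filter _ (by decide)), cnt,
      List.countP_eq_length_filter]
  have h3 := Finset.card_add_card_compl C
  rw [Fintype.card_fun, Fintype.card_bool, Fintype.card_fin] at h3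
  omega

/-- The combinatorial heart: extracted from the finite check. -/
theorem unique_edges (C : Finset (Fin 4 → Bool)) (hvc : vcDim C = 2)
    (hmaximal : ∀ C' : Finset (Fin 4 → Bool), C ⊆ C' → vcDim C' = 2 → C' = C)
    (hnotmax : C.card ≠ 11) :
    C.card = 10 ∧ ∀ i : Fin 4, ∃! u : Fin 4 → Bool,
      u i = false ∧ u ∉ C ∧ Function.update u i true ∉ C := by
  choose e he0 he1 he2 using edge_of_vcDim_le hvc.le
  set m := fourMask (code (e 0)) (code (e 1)) (code (e 2)) (code (e 3)) with hm
  have hbit : ∀ v, m.testBit (code v) = true ↔ ∃ i, v = e i ∨ v = Function.update (e i) i true := by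
    intro v
    have hc : ∀ u : Fin 4 → Bool, code u = code v ↔ v = u :=
      fun u => ⟨fun h => (code_inj _ _ h).symm, fun h => h ▸ rfl⟩
    simp only [hm, fourMask, pairMask, ← code_update _ _ (he0 _), Nat.testBit_or,
      Nat.testBit_two_pow, Bool.or_eq_true, decide_eq_true_eq, hc, Fin.exists_fin_succ,
      Fin.exists_fin_zero]
    simp [or_assoc]
  have hD : ∀ v, v ∉ C ↔ m.testBit (code v) = true := by
    intro v
    rw [hbit]
    constructor
    · intro hv
      by_contra hne
      push Not at hne
      exact minimal_of_maximal hvc hmaximal hv fun i =>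
        ⟨e i, he0 i, ⟨he1 i, (hne i).1.symm⟩, he2 i, (hne i).2.symm⟩
    · rintro ⟨i, rfl | rfl⟩
      exacts [he1 i, he2 i]
  have hcard := card_eq_cnt C m hD
  have hred : redundant m = false := by
    by_contra hr
    rw [Bool.not_eq_false, redundant, List.any_eq_true] at hr
    obtain ⟨j, hj, hr⟩ := hr
    rw [Bool.and_eq_true] at hr
    have : ∀ j ∈ points, j < 16 := by decide
    obtain ⟨v, rfl⟩ := code_surj j (this j hj)
    refine minimal_of_maximal hvc hmaximal ((hD v).2 hr.1) fun i => ?_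
    obtain ⟨u, h0, h1, h2⟩ := exists_of_isComplete _ hr.2 i
    have hx : ∀ w, (m ^^^ 2 ^ code v).testBit (code w) = true → w ∉ C ∧ w ≠ v := by
      intro w hw
      rw [Nat.testBit_xor, Nat.testBit_two_pow] at hw
      by_cases hwv : w = v
      · subst hwv
        simp [hr.1] at hw
      · have : code v ≠ code w := fun h => hwv (code_inj _ _ h).symm
        simp only [this, decide_false, Bool.xor_false] at hw
        exact ⟨(hD w).2 hw, hwv⟩
    exact ⟨u, h0, hx _ h1, hx _ h2⟩
  have l0 : ∀ u : Fin 4 → Bool, u 0 = false → code u ∈ [0,2,4,6,8,10,12,14] := by decide +kernel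
  have l1 : ∀ u : Fin 4 → Bool, u 1 = false → code u ∈ [0,1,4,5,8,9,12,13] := by decide +kernel
  have l2 : ∀ u : Fin 4 → Bool, u 2 = false → code u ∈ [0,1,2,3,8,9,10,11] := by decide +kernel
  have l3 : ∀ u : Fin 4 → Bool, u 3 = false → code u ∈ [0,1,2,3,4,5,6,7] := by decide +kernel
  have hv := List.all_eq_true.1 (List.all_eq_true.1 (List.all_eq_true.1 (List.all_eq_true.1 core
    _ (l0 _ (he0 0))) _ (l1 _ (he0 1))) _ (l2 _ (he0 2))) _ (l3 _ (he0 3))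
  rw [← hm, verdict, hred, Bool.false_or] at hv
  simp only [Bool.or_eq_true, Bool.and_eq_true, Nat.beq_eq] at hv
  rcases hv with hv | ⟨h6, q0, q1, q2, q3⟩
  · omega
  refine ⟨by omega, fun i => ⟨e i, ⟨he0 i, he1 i, he2 i⟩, ?_⟩⟩
  rintro u ⟨a, b, c⟩
  have hq : edgeMask i m = 2 ^ code (e i) := by
    fin_cases i
    exacts [q0, q1, q2, q3]
  have := (testBit_edgeMask i m u).2 ⟨a, (hD _).1 b, (hD _).1 c⟩
  rw [hq, Nat.testBit_two_pow, decide_eq_true_eq] at this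
  exact (code_inj _ _ this).symm


theorem adj_iff (C : Finset (Fin 4 → Bool)) (u v : {v : Fin 4 → Bool // v ∉ C}) :
    (complementGraph C).Adj u v ↔ ∃ i, u.1 i ≠ v.1 i ∧ ∀ j, j ≠ i → u.1 j = v.1 j := by
  have h1 : ∀ a b : Fin 4 → Bool, (∃! i, a i ≠ b i) ↔ ∃ i, a i ≠ b i ∧ ∀ j, j ≠ i → a j = b j := by
    intro a b
    refine exists_congr fun i => and_congr_right fun _ => forall_congr' fun j => ?_
    tauto
  simp only [complementGraph, SimpleGraph.fromRel_adj, h1]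
  constructor
  · rintro ⟨-, ⟨i, a, b⟩ | ⟨i, a, b⟩⟩
    · exact ⟨i, a, b⟩
    · exact ⟨i, a.symm, fun j hj => (b j hj).symm⟩
  · rintro ⟨i, a, b⟩
    exact ⟨fun h => a (by rw [h]), Or.inl ⟨i, a, b⟩⟩

/-- A maximal VC-2 class in the 4-cube which is not maximum: its complement is a
forest with exactly 4 edges, one varying in each coordinate direction, having
exactly 2 connected components, and the deficiency of `C` is 1. -/
theorem maximal_vc2_in_4cube (C : Finset (Fin 4 → Bool))
    (hvc : vcDim C = 2)
    (hmaximal : ∀ C' : Finset (Fin 4 → Bool), C ⊆ C' → vcDim C' = 2 → C' = C)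
    (hnotmax : C.card ≠ ∑ i ∈ Finset.range 3, (4 : ℕ).choose i) :
    (complementGraph C).IsAcyclic ∧
    Nat.card (complementGraph C).edgeSet = 4 ∧
    (∀ i : Fin 4, ∃! u : Fin 4 → Bool,
      u i = false ∧ u ∉ C ∧ Function.update u i true ∉ C) ∧
    Nat.card (complementGraph C).ConnectedComponent = 2 ∧
    (∑ i ∈ Finset.range 3, (4 : ℕ).choose i) - C.card = 1 := by
  have hsum : (∑ i ∈ Finset.range 3, (4 : ℕ).choose i) = 11 := by decide
  rw [hsum] at hnotmax ⊢
  obtain ⟨hcard, huniq⟩ := unique_edges C hvc hmaximal hnotmax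
  choose e he heu using huniq
  let E : Fin 4 → Sym2 {v : Fin 4 → Bool // v ∉ C} := fun i =>
    s(⟨e i, (he i).2.1⟩, ⟨Function.update (e i) i true, (he i).2.2⟩)
  have hEdge1 : ∀ (i : Fin 4) (u v : {v : Fin 4 → Bool // v ∉ C}), u.1 i = false → v.1 i = true →
      (∀ j, j ≠ i → u.1 j = v.1 j) → s(u, v) = E i := by
    intro i u v hu hv h
    have h1 : Function.update u.1 i true = v.1 := by
      funext j
      by_cases hj : j = i
      · subst hj
        simp [hv]
      · rw [Function.update_of_ne hj, h j hj]
    have h2 : u.1 = e i := heu i u.1 ⟨hu, u.2, by rw [h1]; exact v.2⟩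
    have h3 : u = ⟨e i, (he i).2.1⟩ := Subtype.ext h2
    have h4 : v = ⟨Function.update (e i) i true, (he i).2.2⟩ :=
      Subtype.ext (by rw [← h1, h2])
    rw [h3, h4]
  have hEdge : ∀ (i : Fin 4) (u v : {v : Fin 4 → Bool // v ∉ C}), u.1 i ≠ v.1 i →
      (∀ j, j ≠ i → u.1 j = v.1 j) → s(u, v) = E i := by
    intro i u v hne h
    cases hu : u.1 i
    · exact hEdge1 i u v hu (by simpa [hu] using hne.symm) h
    · rw [Sym2.eq_swap]
      exact hEdge1 i v u (by simpa [hu] using hne.symm) hu (fun j hj => (h j hj).symm)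
  have hacyc : (complementGraph C).IsAcyclic := by
    rw [SimpleGraph.isAcyclic_iff_forall_adj_isBridge]
    intro u v huv
    obtain ⟨i, hne, hj⟩ := (adj_iff C u v).1 huv
    rw [SimpleGraph.isBridge_iff]
    have inv : ∀ x y, ((complementGraph C).deleteEdges {s(u, v)}).Walk x y → x.1 i = y.1 i := by
      intro x y p
      induction p with
      | nil => rfl
      | cons h _ ih =>
        rw [← ih]
        rw [SimpleGraph.deleteEdges_adj, adj_iff] at h
        obtain ⟨⟨k, hk, hk2⟩, hn⟩ := h
        by_contra hc
        apply hn
        have hki : k = i := by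
          by_contra hki
          exact hc (hk2 i (Ne.symm hki))
        subst hki
        rw [Set.mem_singleton_iff, hEdge k _ _ hk hk2, hEdge k _ _ hne hj]
    rintro ⟨p⟩
    exact hne (inv u v p)
  have hEset : (complementGraph C).edgeSet = Set.range E := by
    ext x
    induction x using Sym2.ind with
    | _ u v =>
      rw [SimpleGraph.mem_edgeSet]
      constructor
      · intro h
        obtain ⟨i, a, b⟩ := (adj_iff C u v).1 h
        exact ⟨i, (hEdge i u v a b).symm⟩
      · rintro ⟨i, hi⟩
        rw [← SimpleGraph.mem_edgeSet, ← hi, SimpleGraph.mem_edgeSet, adj_iff]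
        refine ⟨i, by simp [(he i).1], fun j hj => ?_⟩
        simp [Function.update_of_ne hj]
  have hEinj : Function.Injective E := by
    intro i k hik
    by_contra hne
    have h1 : e i i = (Function.update (e i) i true) i := by
      rcases Sym2.eq_iff.1 hik with ⟨a, b⟩ | ⟨a, b⟩
      · have a' := congrArg Subtype.val a
        have b' := congrArg Subtype.val b
        simp only at a' b'
        rw [b', a', Function.update_of_ne hne]
      · have a' := congrArg Subtype.val a
        have b' := congrArg Subtype.val b
        simp only at a' b'
        rw [b', a', Function.update_of_ne hne]
    simp [(he i).1] at h1
  have hEcard : Nat.card (complementGraph C).edgeSet = 4 := by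
    rw [hEset, Nat.card_range_of_injective hEinj]
    simp
  have hV : Nat.card {v : Fin 4 → Bool // v ∉ C} = 6 := by
    rw [Nat.card_eq_fintype_card, Fintype.card_subtype_compl]
    simp [hcard]
  have hcount := forest_count _ hacyc
  refine ⟨hacyc, hEcard, fun i => ⟨e i, he i, heu i⟩, by omega, by omega⟩
end
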